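/- arXiv:1311.0274 — 2 statements merged into one kernel-verified Lean document; each statement's English description precedes it below -/
import Mathlib

section
/- Let X ∈ ℝ^{n×p}, θ0 ∈ ℝ^p, w ∈ ℝ^n, λ > 0, and set Y = Xθ0 + w. Let θ̂ be a minimizer over ℝ^p of the Lasso cost θ ↦ (1/(2n))‖Y − Xθ‖₂² + λ‖θ‖₁. If ‖Xᵀw‖_∞ ≤ nλ/2, then for every index i with θ̂_i ≠ 0, | (XᵀX(θ0 − θ̂))_i | ≥ nλ/2. -/
open Matrix

/-- Lasso cost function: `θ ↦ (1/(2n)) ‖Y - Xθ‖₂² + λ ‖θ‖₁`. -/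
noncomputable def lassoCost {n p : ℕ} (Y : Fin n → ℝ) (X : Matrix (Fin n) (Fin p) ℝ)
    (lam : ℝ) (θ : Fin p → ℝ) : ℝ :=
  (1 / (2 * n)) * ∑ i, (Y i - X.mulVec θ i) ^ 2 + lam * ∑ j, |θ j|

/-- The derivative of the Lasso cost along the `i`-th coordinate at a point whose `i`-th entry is
nonzero. -/
theorem hasDerivAt_lassoCost_add_single {n p : ℕ} (Y : Fin n → ℝ) (X : Matrix (Fin n) (Fin p) ℝ)
    (lam : ℝ) (θ : Fin p → ℝ) {i : Fin p} (hi : θ i ≠ 0) :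
    HasDerivAt (fun t : ℝ => lassoCost Y X lam (θ + Pi.single i t))
      (-(1 / n) * (Xᵀ *ᵥ (Y - X *ᵥ θ)) i + lam * (SignType.sign (θ i) : ℝ)) 0 := by
  have hres (k : Fin n) : HasDerivAt (fun t : ℝ => (Y k - (X *ᵥ (θ + Pi.single i t)) k) ^ 2)
      (-2 * (X k i * (Y k - (X *ᵥ θ) k))) 0 := by
    have hlin : HasDerivAt (fun t : ℝ => Y k - ((X *ᵥ θ) k + X k i * t)) (-(X k i * 1)) 0 :=
      (((hasDerivAt_id (0 : ℝ)).const_mul (X k i)).const_add _).const_sub _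
    have hcongr : (fun t : ℝ => (Y k - (X *ᵥ (θ + Pi.single i t)) k) ^ 2) =
        fun t => (Y k - ((X *ᵥ θ) k + X k i * t)) ^ 2 := by
      ext t
      simp [mulVec_add, mulVec_single, mul_comm]
    rw [hcongr]
    refine (hlin.fun_pow 2).congr_deriv ?_
    simp
    ring
  have habs (j : Fin p) : HasDerivAt (fun t : ℝ => |(θ + Pi.single i t : Fin p → ℝ) j|)
      (if j = i then (SignType.sign (θ i) : ℝ) else 0) 0 := by
    split_ifs with hj
    · subst hj
      have hshift : HasDerivAt (fun t : ℝ => θ j + t) 1 0 := (hasDerivAt_id (0 : ℝ)).const_add _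
      have hsign : HasDerivAt (fun x : ℝ => |x|) (SignType.sign (θ j) : ℝ) (θ j + 0) := by
        simpa using hasDerivAt_abs hi
      simpa [Function.comp_def] using hsign.comp (0 : ℝ) hshift
    · simpa [hj] using hasDerivAt_const (0 : ℝ) |θ j|
  have hsum := ((HasDerivAt.fun_sum fun k (_ : k ∈ Finset.univ) => hres k).const_mul
    (1 / (2 * (n : ℝ)))).add
      ((HasDerivAt.fun_sum fun j (_ : j ∈ Finset.univ) => habs j).const_mul lam)
  refine hsum.congr_deriv ?_
  rw [← Finset.mul_sum, Finset.sum_ite_eq' Finset.univ i, if_pos (Finset.mem_univ i)]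
  simp only [mulVec, dotProduct, transpose_apply, Pi.sub_apply]
  ring

/-- Stationarity of the Lasso cost on the support of a minimizer. -/
theorem transpose_mulVec_residual_eq_of_isMinOn_lassoCost {n p : ℕ} (hn : 0 < n) {Y : Fin n → ℝ}
    {X : Matrix (Fin n) (Fin p) ℝ} {lam : ℝ} {θ : Fin p → ℝ}
    (hθ : IsMinOn (lassoCost Y X lam) Set.univ θ) {i : Fin p} (hi : θ i ≠ 0) :
    (Xᵀ *ᵥ (Y - X *ᵥ θ)) i = n * lam * (SignType.sign (θ i) : ℝ) := by
  have hmin : IsLocalMin (fun t : ℝ => lassoCost Y X lam (θ + Pi.single i t)) 0 :=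
    Filter.Eventually.of_forall fun t => by
      simp only [Pi.single_zero, add_zero]
      exact isMinOn_iff.mp hθ _ (Set.mem_univ _)
  have hzero := hmin.hasDerivAt_eq_zero (hasDerivAt_lassoCost_add_single Y X lam θ hi)
  have hn' : (n : ℝ) ≠ 0 := by positivity
  field_simp at hzero
  linarith

/-- If `‖Xᵀw‖_∞ ≤ nλ/2` then on the support of the Lasso solution `θ̂`,
`|(XᵀX(θ₀ - θ̂))_i| ≥ nλ/2`. -/
theorem lasso_support_gradient_lower_bound (n p : ℕ) (hn : 0 < n)
    (X : Matrix (Fin n) (Fin p) ℝ) (θ0 : Fin p → ℝ) (w : Fin n → ℝ)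
    (lam : ℝ) (hlam : 0 < lam)
    (Y : Fin n → ℝ) (hY : Y = X.mulVec θ0 + w)
    (θhat : Fin p → ℝ) (hθ : IsMinOn (lassoCost Y X lam) Set.univ θhat)
    (hw : ∀ i, |Xᵀ.mulVec w i| ≤ n * lam / 2) :
    ∀ i, θhat i ≠ 0 → n * lam / 2 ≤ |(Xᵀ * X).mulVec (θ0 - θhat) i| := by
  intro i hi
  have hstat := transpose_mulVec_residual_eq_of_isMinOn_lassoCost hn hθ hi
  have hsplit : (Xᵀ *ᵥ (Y - X *ᵥ θhat)) i = ((Xᵀ * X) *ᵥ (θ0 - θhat)) i + (Xᵀ *ᵥ w) i := by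
    have hres : Y - X *ᵥ θhat = X *ᵥ (θ0 - θhat) + w := by
      rw [hY, mulVec_sub]
      abel
    rw [hres, mulVec_add, mulVec_mulVec, Pi.add_apply]
  have habs : |(Xᵀ *ᵥ (Y - X *ᵥ θhat)) i| = n * lam := by
    have hpos : 0 < n * lam := by positivity
    rw [hstat, abs_mul, abs_of_pos hpos]
    rcases hi.lt_or_gt with h | h <;> simp [h]
  have htri := abs_add_le (((Xᵀ * X) *ᵥ (θ0 - θhat)) i) ((Xᵀ *ᵥ w) i)
  rw [← hsplit, habs] at htri
  linarith [hw i]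
end

section
/- Let X ∈ ℝ^{n×p}, θ0 ∈ ℝ^p, w ∈ ℝ^n, λ > 0, and Y = Xθ0 + w. Let θ̂ be a minimizer over ℝ^p of the Lasso cost θ ↦ (1/(2n))‖Y − Xθ‖₂² + λ‖θ‖₁, and suppose ‖Xᵀw‖_∞ ≤ nλ/2 and θ̂ ≠ 0. Let Ŝ = supp(θ̂). Then |Ŝ| · λ²/4 ≤ φ_max(|Ŝ|) · ‖X(θ0 − θ̂)‖₂² / n, where φ_max(t) = max{ ‖Xv‖₂² / (n ‖v‖₂²) : v ∈ ℝ^p, 1 ≤ ‖v‖₀ ≤ t }. -/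
open Matrix

/-- Restricted maximal eigenvalue:
`φ_max(t) = max { ‖Xv‖₂²/(n ‖v‖₂²) : v ≠ 0, ‖v‖₀ ≤ t }`. -/
noncomputable def phiMax {n p : ℕ} (X : Matrix (Fin n) (Fin p) ℝ) (t : ℕ) : ℝ :=
  sSup {r : ℝ | ∃ v : Fin p → ℝ, v ≠ 0 ∧
    (Finset.univ.filter fun j => v j ≠ 0).card ≤ t ∧
    r = (∑ i, (X.mulVec v i) ^ 2) / (n * ∑ j, (v j) ^ 2)}

/-- A quadratic without constant term that is nonnegative on `[-1, 1]` has no linear term. -/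
theorem linear_coeff_eq_zero_of_nonneg {a b : ℝ} (hb : 0 ≤ b)
    (h : ∀ s : ℝ, |s| ≤ 1 → 0 ≤ s * a + s ^ 2 * b) : a = 0 := by
  have hD : 0 < |a| + b + 1 := by positivity
  have h1 := h (-a / (|a| + b + 1)) (by
    rw [abs_div, abs_neg, abs_of_pos hD, div_le_one hD]
    linarith)
  have h2 : -a / (|a| + b + 1) * a + (-a / (|a| + b + 1)) ^ 2 * b
      = -(a ^ 2 * (|a| + 1)) / (|a| + b + 1) ^ 2 := by
    field_simp
    ring
  rw [h2, le_div_iff₀ (by positivity)] at h1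
  have h3 : a ^ 2 ≤ 0 := by
    nlinarith [mul_nonneg (sq_nonneg a) (abs_nonneg a)]
  exact pow_eq_zero_iff two_ne_zero |>.mp (le_antisymm h3 (sq_nonneg a))

theorem mulVec_sq_sum_le {n p : ℕ} (X : Matrix (Fin n) (Fin p) ℝ) (v : Fin p → ℝ) :
    ∑ i, (X.mulVec v i) ^ 2 ≤ (∑ i, ∑ j, X i j ^ 2) * ∑ j, v j ^ 2 := by
  rw [Finset.sum_mul]
  exact Finset.sum_le_sum fun i _ => Finset.sum_mul_sq_le_sq_mul_sq Finset.univ (X i) v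

/-- The variational bound defining the restricted maximal eigenvalue. -/
theorem mulVec_sq_sum_le_phiMax {n p : ℕ} (hn : 0 < n) (X : Matrix (Fin n) (Fin p) ℝ) {t : ℕ}
    {v : Fin p → ℝ} (hv : v ≠ 0) (ht : (Finset.univ.filter fun j => v j ≠ 0).card ≤ t) :
    ∑ i, (X.mulVec v i) ^ 2 ≤ phiMax X t * (n * ∑ j, v j ^ 2) := by
  have hn' : (0 : ℝ) < n := by exact_mod_cast hn
  have pos : ∀ u : Fin p → ℝ, u ≠ 0 → 0 < ∑ j, u j ^ 2 := by
    intro u hu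
    obtain ⟨j, hj⟩ := Function.ne_iff.mp hu
    exact Finset.sum_pos' (fun _ _ => sq_nonneg _) ⟨j, Finset.mem_univ j, by
      have : u j ≠ 0 := hj
      positivity⟩
  rw [← div_le_iff₀ (mul_pos hn' (pos v hv))]
  refine le_csSup ⟨(∑ i, ∑ j, X i j ^ 2) / n, ?_⟩ ⟨v, hv, ht, rfl⟩
  rintro r ⟨u, hu, -, rfl⟩
  rw [div_le_div_iff₀ (mul_pos hn' (pos u hu)) hn']
  nlinarith [mul_le_mul_of_nonneg_left (mulVec_sq_sum_le X u) hn'.le]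

/-- Stationarity of the Lasso cost in an active coordinate. -/
theorem abs_transpose_mulVec_residual_eq {n p : ℕ} (hn : 0 < n) {X : Matrix (Fin n) (Fin p) ℝ}
    {Y : Fin n → ℝ} {lam : ℝ} (hlam : 0 < lam) {θ : Fin p → ℝ}
    (hθ : IsMinOn (lassoCost Y X lam) Set.univ θ) {j : Fin p} (hj : θ j ≠ 0) :
    |Xᵀ.mulVec (Y - X.mulVec θ) j| = n * lam := by
  have hn' : (0 : ℝ) < n := by exact_mod_cast hn
  set c := Xᵀ.mulVec (Y - X.mulVec θ) j with hc
  have hc' : c = ∑ i, X i j * (Y i - X.mulVec θ i) := rfl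
  have key : -(θ j * c / n) + lam * |θ j| = 0 := by
    refine linear_coeff_eq_zero_of_nonneg
      (b := 1 / (2 * n) * (θ j ^ 2 * ∑ i, X i j ^ 2)) (by positivity) fun s hs => ?_
    have hmin : lassoCost Y X lam θ ≤ lassoCost Y X lam (θ + Pi.single j (s * θ j)) :=
      hθ (Set.mem_univ _)
    have hquad : ∑ i, (Y i - X.mulVec (θ + Pi.single j (s * θ j)) i) ^ 2
        = ∑ i, (Y i - X.mulVec θ i) ^ 2 - 2 * (s * θ j) * c
          + (s * θ j) ^ 2 * ∑ i, X i j ^ 2 := by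
      rw [hc', Finset.mul_sum, Finset.mul_sum, ← Finset.sum_sub_distrib,
        ← Finset.sum_add_distrib]
      refine Finset.sum_congr rfl fun i _ => ?_
      simp only [Matrix.mulVec_add, Pi.add_apply, Matrix.mulVec_single, Pi.smul_apply,
        Matrix.col_apply, MulOpposite.smul_eq_mul_unop, MulOpposite.unop_op]
      ring
    have habs : ∑ k, |(θ + Pi.single j (s * θ j) : Fin p → ℝ) k|
        = ∑ k, |θ k| + s * |θ j| := by
      rw [← Finset.add_sum_erase _ _ (Finset.mem_univ j),
        ← Finset.add_sum_erase _ (fun k => |θ k|) (Finset.mem_univ j)]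
      have h1 : |θ j + s * θ j| = (1 + s) * |θ j| := by
        rw [← one_add_mul, abs_mul, abs_of_nonneg (by linarith [(abs_le.mp hs).1])]
      have h2 : ∑ k ∈ Finset.univ.erase j, |(θ + Pi.single j (s * θ j) : Fin p → ℝ) k|
          = ∑ k ∈ Finset.univ.erase j, |θ k| :=
        Finset.sum_congr rfl fun k hk => by simp [Pi.single_eq_of_ne (Finset.ne_of_mem_erase hk)]
      rw [h2, Pi.add_apply, Pi.single_eq_same, h1]
      ring
    unfold lassoCost at hmin
    rw [hquad, habs] at hmin
    have hlin : 1 / (2 * (n : ℝ)) * (2 * (s * θ j) * c) = s * (θ j * c / n) := by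
      field_simp
    linarith
  have h1 : θ j * c = n * lam * |θ j| := by
    field_simp at key
    linarith
  have h2 : |θ j| * |c| = |θ j| * (n * lam) := by
    rw [← abs_mul, h1, abs_of_nonneg (by positivity)]
    ring
  exact mul_left_cancel₀ (abs_ne_zero.mpr hj) h2

/-- A vector supported on at most `t` coordinates where it agrees with `Xᵀ u` is controlled by
the restricted maximal eigenvalue. -/
theorem sum_sq_transpose_mulVec_le {n p : ℕ} (hn : 0 < n) (X : Matrix (Fin n) (Fin p) ℝ)
    (u : Fin n → ℝ) (S : Finset (Fin p)) (hS : ∃ j ∈ S, Xᵀ.mulVec u j ≠ 0) :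
    ∑ j ∈ S, (Xᵀ.mulVec u j) ^ 2 ≤ phiMax X S.card * n * ∑ i, u i ^ 2 := by
  set g : Fin p → ℝ := fun j => if j ∈ S then Xᵀ.mulVec u j else 0 with hg
  obtain ⟨k, hkS, hk⟩ := hS
  have hg0 : g ≠ 0 := fun h => hk (by simpa [hg, hkS] using congrFun h k)
  have hcard : (Finset.univ.filter fun j => g j ≠ 0).card ≤ S.card := by
    refine Finset.card_le_card fun j hj => ?_
    by_contra hjS
    simp [hg, hjS] at hj
  have hsq : ∑ j, g j ^ 2 = ∑ j ∈ S, (Xᵀ.mulVec u j) ^ 2 := by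
    simp [hg, ite_pow]
  have hinner : ∑ i, X.mulVec g i * u i = ∑ j, g j ^ 2 := by
    calc ∑ i, X.mulVec g i * u i = X.mulVec g ⬝ᵥ u := rfl
      _ = g ⬝ᵥ Xᵀ.mulVec u := by
        rw [dotProduct_comm, Matrix.dotProduct_mulVec, Matrix.mulVec_transpose, dotProduct_comm]
      _ = ∑ j, g j ^ 2 := by
        refine Finset.sum_congr rfl fun j _ => ?_
        by_cases hj : j ∈ S <;> simp [hg, hj, sq]
  have hpos : 0 < ∑ j, g j ^ 2 := by
    rw [hsq]
    exact Finset.sum_pos' (fun _ _ => sq_nonneg _) ⟨k, hkS, by positivity⟩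
  have hcs := Finset.sum_mul_sq_le_sq_mul_sq Finset.univ (X.mulVec g) u
  have hphi := mul_le_mul_of_nonneg_right (mulVec_sq_sum_le_phiMax hn X hg0 hcard)
    (Finset.sum_nonneg fun i (_ : i ∈ Finset.univ) => sq_nonneg (u i))
  rw [hinner] at hcs
  rw [← hsq]
  refine le_of_mul_le_mul_left ?_ hpos
  linarith

/-- **Bound on the Lasso support size.**
`|Ŝ| λ²/4 ≤ φ_max(|Ŝ|) ‖X(θ₀ - θ̂)‖₂² / n`. -/
theorem lasso_support_size_bound (n p : ℕ) (hn : 0 < n)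
    (X : Matrix (Fin n) (Fin p) ℝ) (θ0 : Fin p → ℝ) (w : Fin n → ℝ)
    (lam : ℝ) (hlam : 0 < lam)
    (Y : Fin n → ℝ) (hY : Y = X.mulVec θ0 + w)
    (θhat : Fin p → ℝ) (hθ : IsMinOn (lassoCost Y X lam) Set.univ θhat)
    (hw : ∀ i, |Xᵀ.mulVec w i| ≤ n * lam / 2) (hθne : θhat ≠ 0)
    (Shat : Finset (Fin p)) (hShat : Shat = Finset.univ.filter fun j => θhat j ≠ 0) :
    (Shat.card : ℝ) * lam ^ 2 / 4 ≤
      phiMax X Shat.card * (∑ i, (X.mulVec (θ0 - θhat) i) ^ 2) / n := by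
  have hn' : (0 : ℝ) < n := by exact_mod_cast hn
  have hres : Y - X.mulVec θhat = w + X.mulVec (θ0 - θhat) := by
    rw [hY, Matrix.mulVec_sub]
    abel
  have hlow : ∀ j ∈ Shat, n * lam / 2 ≤ |Xᵀ.mulVec (X.mulVec (θ0 - θhat)) j| := by
    intro j hj
    rw [hShat, Finset.mem_filter] at hj
    have h := abs_transpose_mulVec_residual_eq hn hlam hθ hj.2
    rw [hres, Matrix.mulVec_add, Pi.add_apply] at h
    linarith [abs_add_le (Xᵀ.mulVec w j) (Xᵀ.mulVec (X.mulVec (θ0 - θhat)) j), hw j]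
  have hhalf : 0 < n * lam / 2 := by positivity
  obtain ⟨k, hk⟩ := Function.ne_iff.mp hθne
  have hkS : k ∈ Shat := by
    rw [hShat]
    exact Finset.mem_filter.mpr ⟨Finset.mem_univ k, hk⟩
  have hupper := sum_sq_transpose_mulVec_le hn X (X.mulVec (θ0 - θhat)) Shat
    ⟨k, hkS, abs_pos.mp (hhalf.trans_le (hlow k hkS))⟩
  have hlower : Shat.card * (n * lam / 2) ^ 2
      ≤ ∑ j ∈ Shat, (Xᵀ.mulVec (X.mulVec (θ0 - θhat)) j) ^ 2 := by
    rw [← nsmul_eq_mul]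
    refine Finset.card_nsmul_le_sum _ _ _ fun j hj => ?_
    rw [← sq_abs (Xᵀ.mulVec _ j)]
    exact pow_le_pow_left₀ hhalf.le (hlow j hj) 2
  rw [le_div_iff₀ hn']
  refine le_of_mul_le_mul_left ?_ hn'
  linarith
end
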